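/- Let B be a reward respecting partition of a finite MDP M = ⟨S,A,Φ,P,R⟩, let b be a block of B, and let C ⊆ S be a union of blocks of the projection B|S. Then every reward respecting SSP partition of Φ that is a refinement of B is also a refinement of Split(b,C,B). -/

import Mathlib

open Classical in
/-- Block transition probability `T(s,a,C) = Σ_{s'' ∈ C} P(s,a,s'')`. -/
noncomputable def blockT {S A : Type} [Fintype S] (P : S → A → S → ℝ)
    (s : S) (a : A) (C : Set S) : ℝ :=
  ∑ s' : S, if s' ∈ C then P s a s' else 0

/-- `B` is a partition of the set `Φ`. -/
def IsPartition {X : Type} (Φ : Set X) (B : Set (Set X)) : Prop :=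
  (∀ b ∈ B, b.Nonempty) ∧ (⋃₀ B = Φ) ∧
    (∀ b ∈ B, ∀ c ∈ B, b ≠ c → Disjoint b c)

/-- `p` and `q` lie in the same block of `B`. -/
def SameBlock {X : Type} (B : Set (Set X)) (p q : X) : Prop :=
  ∃ b ∈ B, p ∈ b ∧ q ∈ b

/-- `B(s)`: the set of blocks of `B` containing a pair whose state component is `s`. -/
def stateBlocks {S A : Type} (B : Set (Set (S × A))) (s : S) : Set (Set (S × A)) :=
  {b ∈ B | ∃ a, (s, a) ∈ b}

/-- The block `[s]_{B|S}` of the projection `B|S` containing the state `s`. -/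
def projBlock {S A : Type} (B : Set (Set (S × A))) (s : S) : Set S :=
  {s' | stateBlocks B s' = stateBlocks B s}

/-- The projection `B|S` of a state-action partition `B` onto the state space. -/
def proj {S A : Type} (B : Set (Set (S × A))) : Set (Set S) :=
  Set.range (projBlock B)

/-- `B'` is a refinement of `B`: every block of `B'` is a subset of some block of `B`. -/
def Refines {X : Type} (B' B : Set (Set X)) : Prop :=
  ∀ b' ∈ B', ∃ b ∈ B, b' ⊆ b

/-- `C` is a union of blocks of the partition `B`. -/
def UnionOfBlocks {X : Type} (B : Set (Set X)) (C : Set X) : Prop :=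
  ∃ 𝒞 ⊆ B, C = ⋃₀ 𝒞

/-- A partition is reward respecting if state-action pairs in the same block
get the same reward. -/
def RewardRespecting {S A : Type} (R : S → A → ℝ) (B : Set (Set (S × A))) : Prop :=
  ∀ p q : S × A, SameBlock B p q → R p.1 p.2 = R q.1 q.2

/-- Stochastic substitution property. -/
def SSP {S A : Type} [Fintype S] (P : S → A → S → ℝ) (B : Set (Set (S × A))) : Prop :=
  ∀ p q : S × A, SameBlock B p q →
    ∀ c ∈ proj B, blockT P p.1 p.2 c = blockT P q.1 q.2 c

/-- `Split(b,C,B)`: replace the block `b` of `B` by the nonempty level sets of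
`(s,a) ↦ T(s,a,C)` restricted to `b`. -/
def split {S A : Type} [Fintype S] (P : S → A → S → ℝ) (b : Set (S × A)) (C : Set S)
    (B : Set (Set (S × A))) : Set (Set (S × A)) :=
  (B \ {b}) ∪ {d | d.Nonempty ∧ ∃ r : ℝ, d = {p ∈ b | blockT P p.1 p.2 C = r}}

/-- The conditions making `⟨S,A,Φ,P,R⟩` a finite MDP: every state has an admissible
action, and `P(s,a,·)` is a probability distribution for each admissible `(s,a)`. -/
def IsMDP {S A : Type} [Fintype S] [Fintype A] (Φ : Set (S × A))
    (P : S → A → S → ℝ) : Prop :=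
  (∀ s : S, ∃ a : A, (s, a) ∈ Φ) ∧
  (∀ p ∈ Φ, ∀ s' : S, 0 ≤ P p.1 p.2 s' ∧ P p.1 p.2 s' ≤ 1) ∧
  (∀ p ∈ Φ, ∑ s' : S, P p.1 p.2 s' = 1)

/-- The canonical quotient map sending a state to its block of `B|S`. -/
def quotientMap {S A : Type} (B : Set (Set (S × A))) (s : S) : ↥(proj B) :=
  ⟨projBlock B s, ⟨s, rfl⟩⟩

/-- `⟨f, {g_s}⟩` is an MDP homomorphism. -/
def IsMDPHom {S A S' A' : Type} [Fintype S]
    (Φ : Set (S × A)) (P : S → A → S → ℝ) (R : S → A → ℝ)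
    (Φ' : Set (S' × A')) (P' : S' → A' → S' → ℝ) (R' : S' → A' → ℝ)
    (f : S → S') (g : S → A → A') : Prop :=
  Function.Surjective f ∧
  (∀ p ∈ Φ, (f p.1, g p.1 p.2) ∈ Φ') ∧
  (∀ s : S, ∀ a' : A', (f s, a') ∈ Φ' → ∃ a : A, (s, a) ∈ Φ ∧ g s a = a') ∧
  (∀ p ∈ Φ, R p.1 p.2 = R' (f p.1) (g p.1 p.2)) ∧
  (∀ p ∈ Φ, ∀ s' : S,
    blockT P p.1 p.2 {s'' | f s'' = f s'} = P' (f p.1) (g p.1 p.2) (f s'))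

/-- `Q` satisfies the Bellman optimality equation for the MDP `⟨S,A,Φ,P,R⟩`
with discount factor `γ`. -/
noncomputable def IsBellmanSolution {S A : Type} [Fintype S] (Φ : Set (S × A))
    (P : S → A → S → ℝ) (R : S → A → ℝ) (γ : ℝ) (Q : S → A → ℝ) : Prop :=
  ∀ p ∈ Φ, Q p.1 p.2 = R p.1 p.2 +
    γ * ∑ s' : S, P p.1 p.2 s' * sSup {x : ℝ | ∃ a'' : A, (s', a'') ∈ Φ ∧ x = Q s' a''}

theorem mem_projBlock_self {S A : Type} (B : Set (Set (S × A))) (s : S) :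
    s ∈ projBlock B s := rfl

theorem projBlock_eq_iff {S A : Type} (B : Set (Set (S × A))) (s t : S) :
    projBlock B s = projBlock B t ↔ s ∈ projBlock B t := by
  constructor
  · intro h
    exact h ▸ mem_projBlock_self B s
  · intro h
    ext u
    change stateBlocks B u = stateBlocks B s ↔ stateBlocks B u = stateBlocks B t
    rw [show stateBlocks B s = stateBlocks B t from h]

theorem stateBlocks_subset_of_refines {S A : Type} {Φ : Set (S × A)} {B B' : Set (Set (S × A))}
    (hB : IsPartition Φ B) (hB' : IsPartition Φ B') (href : Refines B' B) {s t : S}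
    (h : stateBlocks B' s = stateBlocks B' t) : stateBlocks B s ⊆ stateBlocks B t := by
  rintro c ⟨hc, a, ha⟩
  have hΦ : (s, a) ∈ ⋃₀ B' := by
    rw [hB'.2.1, ← hB.2.1]
    exact ⟨c, hc, ha⟩
  obtain ⟨b', hb', hab'⟩ := hΦ
  have hmem : b' ∈ stateBlocks B' t := h ▸ ⟨hb', a, hab'⟩
  obtain ⟨-, a', ha'⟩ := hmem
  obtain ⟨c', hc', hsub⟩ := href b' hb'
  have hcc : c' = c := by
    by_contra hne
    exact Set.disjoint_left.mp (hB.2.2 c' hc' c hc hne) (hsub hab') ha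
  exact ⟨hc, a', hcc ▸ hsub ha'⟩

theorem projBlock_subset_of_refines {S A : Type} {Φ : Set (S × A)} {B B' : Set (Set (S × A))}
    (hB : IsPartition Φ B) (hB' : IsPartition Φ B') (href : Refines B' B) (s : S) :
    projBlock B' s ⊆ projBlock B s := fun _ ht =>
  (stateBlocks_subset_of_refines hB hB' href ht).antisymm
    (stateBlocks_subset_of_refines hB hB' href (Eq.symm ht))

theorem UnionOfBlocks.projBlock_subset {S A : Type} {B : Set (Set (S × A))} {C : Set S}
    (hC : UnionOfBlocks (proj B) C) {s : S} (hs : s ∈ C) : projBlock B s ⊆ C := by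
  obtain ⟨𝒞, h𝒞, rfl⟩ := hC
  obtain ⟨d, hd, hsd⟩ := hs
  obtain ⟨t, rfl⟩ := h𝒞 hd
  rw [(projBlock_eq_iff B s t).mpr hsd]
  exact Set.subset_sUnion_of_mem hd

open Classical in
/-- The probability of reaching a union of projected blocks is the sum of the
block transition probabilities of the blocks contained in it. -/
theorem blockT_eq_sum_projBlock {S A : Type} [Fintype S] (P : S → A → S → ℝ)
    (B : Set (Set (S × A))) {C : Set S} (hC : ∀ s ∈ C, projBlock B s ⊆ C) (s : S) (a : A) :
    blockT P s a C =
      ∑ d ∈ Finset.univ.image (projBlock B), if d ⊆ C then blockT P s a d else 0 := by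
  unfold blockT
  rw [← Finset.sum_fiberwise_of_maps_to (g := projBlock B)
    (fun x _ => Finset.mem_image_of_mem _ (Finset.mem_univ x))]
  refine Finset.sum_congr rfl fun d hd => ?_
  obtain ⟨t, -, rfl⟩ := Finset.mem_image.mp hd
  rw [Finset.sum_filter]
  simp only [projBlock_eq_iff]
  split_ifs with hsub
  · refine Finset.sum_congr rfl fun u _ => ?_
    by_cases hu : u ∈ projBlock B t
    · simp [hu, hsub hu]
    · simp [hu]
  · refine Finset.sum_eq_zero fun u _ => ?_
    by_cases hu : u ∈ projBlock B t
    · have huC : u ∉ C := fun h => hsub ((projBlock_eq_iff B u t).mpr hu ▸ hC u h)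
      simp [huC]
    · simp [hu]

theorem SSP.blockT_eq {S A : Type} [Fintype S] {P : S → A → S → ℝ} {B : Set (Set (S × A))}
    (hB : SSP P B) {C : Set S} (hC : ∀ s ∈ C, projBlock B s ⊆ C) {p q : S × A}
    (hpq : SameBlock B p q) : blockT P p.1 p.2 C = blockT P q.1 q.2 C := by
  classical
  rw [blockT_eq_sum_projBlock P B hC, blockT_eq_sum_projBlock P B hC]
  refine Finset.sum_congr rfl fun d hd => ?_
  obtain ⟨t, -, rfl⟩ := Finset.mem_image.mp hd
  rw [hB p q hpq _ ⟨t, rfl⟩]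

/-- **Corollary 1.** Let `B` be a reward respecting partition of a finite MDP,
`b` a block of `B` and `C` a union of blocks of `B|S`. Every reward respecting SSP partition
of `Φ` refining `B` also refines `Split(b,C,B)`. -/
theorem stmt2 {S A : Type} [Fintype S] [Fintype A]
    (Φ : Set (S × A)) (P : S → A → S → ℝ) (R : S → A → ℝ)
    (hM : IsMDP Φ P)
    (B : Set (Set (S × A))) (hB : IsPartition Φ B) (hRR : RewardRespecting R B)
    (b : Set (S × A)) (hb : b ∈ B)
    (C : Set S) (hC : UnionOfBlocks (proj B) C)
    (B' : Set (Set (S × A))) (hB' : IsPartition Φ B')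
    (hRR' : RewardRespecting R B') (hSSP' : SSP P B') (href : Refines B' B) :
    Refines B' (split P b C B) := by
  intro b' hb'
  obtain ⟨c, hc, hsub⟩ := href b' hb'
  by_cases hcb : c = b
  · subst hcb
    obtain ⟨p, hp⟩ := hB'.1 b' hb'
    refine ⟨{q ∈ c | blockT P q.1 q.2 C = blockT P p.1 p.2 C},
      Or.inr ⟨⟨p, hsub hp, rfl⟩, _, rfl⟩, fun q hq => ⟨hsub hq, ?_⟩⟩
    exact hSSP'.blockT_eq
      (fun s hs => (projBlock_subset_of_refines hB hB' href s).trans (hC.projBlock_subset hs))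
      ⟨b', hb', hq, hp⟩
  · exact ⟨c, Or.inl ⟨hc, hcb⟩, hsub⟩
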